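/- arXiv:2503.22644 — 9 statements merged into one kernel-verified Lean document; each statement's English description precedes it below -/
import Mathlib

section
/- Let d ≥ 2 and let λ ∈ V with λ_1 < 1. Then F(λ) ∈ V (in particular F(λ) is nonincreasing with F(λ)_1 > F(λ)_2 and its entries sum to 1), and the principal entry strictly increases: F(λ)_1 − λ_1 = λ_1 · (Σ_{j=2}^d (λ_1 − λ_j)·λ_j) / (1 + ‖λ‖²) > 0. -/
open Finset

noncomputable section

/-- Membership in the set `V` of valid spectra (zero-indexed: `lam 0` is `λ₁`). -/
def memV {d : ℕ} [NeZero d] (lam : Fin d → ℝ) : Prop :=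
  (∀ i, 0 ≤ lam i) ∧ (∀ i j : Fin d, i ≤ j → lam j ≤ lam i) ∧
    lam 1 < lam 0 ∧ ∑ i, lam i = 1

/-- The spectrum map induced by a successful swap test:
`F(λ)_i = λ_i(λ_i+1)/(1+‖λ‖²)`. -/
def Fmap {d : ℕ} (lam : Fin d → ℝ) : Fin d → ℝ :=
  fun i => lam i * (lam i + 1) / (1 + ∑ j, lam j ^ 2)

/-- `E(λ) = Σ_{j=2}^d λ_j/(λ_1 - λ_j)`. -/
def Evec {d : ℕ} [NeZero d] (lam : Fin d → ℝ) : ℝ :=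
  ∑ j ∈ Finset.univ.erase (0 : Fin d), lam j / (lam 0 - lam j)

/-- `η(λ) = 1 - λ₁`. -/
def etaV {d : ℕ} [NeZero d] (lam : Fin d → ℝ) : ℝ := 1 - lam 0

theorem one_le_of_ne_zero {d : ℕ} [NeZero d] {j : Fin d} (hj : j ≠ 0) : 1 ≤ j := by
  rw [Fin.le_def]
  have h : (j : ℕ) ≠ 0 := fun h => hj (Fin.ext (by simpa using h))
  change 1 % d ≤ j
  exact (Nat.mod_le 1 d).trans (Nat.one_le_iff_ne_zero.mpr h)

theorem Fmap_zero_sub {d : ℕ} [NeZero d] (lam : Fin d → ℝ) (hsum : ∑ i, lam i = 1) :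
    Fmap lam 0 - lam 0 =
      lam 0 * (∑ j ∈ Finset.univ.erase (0 : Fin d), (lam 0 - lam j) * lam j) /
        (1 + ∑ j, lam j ^ 2) := by
  have hN : 1 + ∑ j, lam j ^ 2 ≠ 0 := by positivity
  have hS : ∑ j ∈ Finset.univ.erase (0 : Fin d), (lam 0 - lam j) * lam j =
      lam 0 - ∑ j, lam j ^ 2 := by
    rw [Finset.sum_erase _ (by simp)]
    simp only [sub_mul, Finset.sum_sub_distrib, ← Finset.mul_sum, hsum, mul_one, sq]
  rw [hS, Fmap, eq_div_iff hN, sub_mul, div_mul_cancel₀ _ hN]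
  ring

theorem sum_gap_mul_pos {d : ℕ} [NeZero d] {lam : Fin d → ℝ} (hV : memV lam)
    (h1 : lam 0 < 1) :
    0 < ∑ j ∈ Finset.univ.erase (0 : Fin d), (lam 0 - lam j) * lam j := by
  obtain ⟨hnn, hanti, hgap, hsum⟩ := hV
  have hrest : ∑ j ∈ Finset.univ.erase (0 : Fin d), lam j = 1 - lam 0 := by
    rw [Finset.sum_erase_eq_sub (Finset.mem_univ _), hsum]
  calc 0 < (lam 0 - lam 1) * (1 - lam 0) := mul_pos (sub_pos.2 hgap) (sub_pos.2 h1)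
    _ = ∑ j ∈ Finset.univ.erase (0 : Fin d), (lam 0 - lam 1) * lam j := by
      rw [← Finset.mul_sum, hrest]
    _ ≤ _ := by
      refine Finset.sum_le_sum fun j hj => mul_le_mul_of_nonneg_right ?_ (hnn j)
      exact sub_le_sub_left (hanti 1 j (one_le_of_ne_zero (Finset.ne_of_mem_erase hj))) _

theorem memV_Fmap {d : ℕ} [NeZero d] {lam : Fin d → ℝ} (hV : memV lam) :
    memV (Fmap lam) := by
  obtain ⟨hnn, hanti, hgap, hsum⟩ := hV
  have hN : 0 < 1 + ∑ j, lam j ^ 2 := by positivity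
  refine ⟨fun i => ?_, fun i j hij => ?_, ?_, ?_⟩
  · have := hnn i
    unfold Fmap
    positivity
  · refine div_le_div_of_nonneg_right ?_ hN.le
    nlinarith [hnn i, hnn j, hanti i j hij]
  · refine div_lt_div_of_pos_right ?_ hN
    nlinarith [hnn 0, hnn 1]
  · simp only [Fmap]
    rw [← Finset.sum_div, div_eq_one_iff_eq hN.ne']
    simp only [mul_add, mul_one, Finset.sum_add_distrib, hsum, ← sq]
    ring

/-- `F` maps `V` to `V` and strictly increases the principal entry,
with the given explicit formula for the increase. -/
theorem stmt0 (d : ℕ) [NeZero d] (hd : 2 ≤ d) (lam : Fin d → ℝ)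
    (hV : memV lam) (h1 : lam 0 < 1) :
    memV (Fmap lam) ∧
      Fmap lam 0 - lam 0 =
        lam 0 * (∑ j ∈ Finset.univ.erase (0 : Fin d), (lam 0 - lam j) * lam j) /
          (1 + ∑ j, lam j ^ 2) ∧
      0 < Fmap lam 0 - lam 0 := by
  refine ⟨memV_Fmap hV, Fmap_zero_sub lam hV.2.2.2, ?_⟩
  rw [Fmap_zero_sub lam hV.2.2.2]
  have hpos : 0 < lam 0 := (hV.1 1).trans_lt hV.2.2.1
  have hS := sum_gap_mul_pos hV h1
  positivity
end
end

section
/- Let Λ, Λ' ∈ 𝒮 be generalized spectra whose vectors have length 2. If Λ ⪰ Λ' then F(Λ) ⪰ F(Λ'). -/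
noncomputable section

/-!
A generalized spectrum `Λ = (q, λ)` is represented by a pair of functions
`q lam : ℕ → ℝ` (zero-indexed, so `lam 0` is `λ₁`), padded with zeros beyond
the (finite) length of the vectors.
-/

/-- `(q, lam)` is a generalized spectrum: `q₁ = 1`, `q ≥ 0`, `λ₁ > λ₂ ≥ λ₃ ≥ ⋯ ≥ 0`,
both vectors have finite length (zero padding), and `Σᵢ qᵢ λᵢ = 1`. -/
def IsGenSpec (q lam : ℕ → ℝ) : Prop :=
  q 0 = 1 ∧ (∀ i, 0 ≤ q i) ∧
  lam 1 < lam 0 ∧ (∀ i, 1 ≤ i → lam (i + 1) ≤ lam i) ∧ (∀ i, 0 ≤ lam i) ∧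
  (∃ N, ∀ i, N ≤ i → q i = 0 ∧ lam i = 0) ∧
  ∑' i, q i * lam i = 1

/-- λ-component of `F(Λ)`: `μᵢ = (λᵢ + λᵢ²)/(1 + Σⱼ qⱼ λⱼ²)`;
the q-component of `F(Λ)` is unchanged. -/
def Fspec (q lam : ℕ → ℝ) : ℕ → ℝ :=
  fun i => (lam i + lam i ^ 2) / (1 + ∑' j, q j * lam j ^ 2)

/-- q-component of `S(Λ) = ((1, (1-λ₁)/λ₂), (λ₁, λ₂))`. -/
def Sq (lam : ℕ → ℝ) : ℕ → ℝ :=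
  fun i => if i = 0 then 1 else if i = 1 then (1 - lam 0) / lam 1 else 0

/-- λ-component of `S(Λ) = ((1, (1-λ₁)/λ₂), (λ₁, λ₂))`. -/
def Slam (lam : ℕ → ℝ) : ℕ → ℝ :=
  fun i => if i ≤ 1 then lam i else 0

/-- `Λ ⪰ Λ'` iff `λ₁(Λ) ≥ λ₁(Λ')` and `Δ(Λ) ≥ Δ(Λ')`, where `Δ = λ₁ - λ₂`.
This depends only on the λ-components. -/
def Succeq (lam lam' : ℕ → ℝ) : Prop :=
  lam' 0 ≤ lam 0 ∧ lam' 0 - lam' 1 ≤ lam 0 - lam 1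

/-- Membership in `𝒮`: the vectors have length 2. -/
def HasLen2 (q lam : ℕ → ℝ) : Prop := ∀ i, 2 ≤ i → q i = 0 ∧ lam i = 0

theorem HasLen2.tsum_mul_eq {q lam : ℕ → ℝ} (hl : HasLen2 q lam) (f : ℕ → ℝ) :
    ∑' i, q i * f i = q 0 * f 0 + q 1 * f 1 := by
  rw [tsum_eq_sum (s := Finset.range 2), Finset.sum_range_succ, Finset.sum_range_one]
  intro i hi
  rw [(hl i (not_lt.1 (mt Finset.mem_range.2 hi))).1, zero_mul]

/-- On spectra of length 2, the normalizing constant of `F` depends only on `λ₁` and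
`Δ = λ₁ - λ₂`. -/
theorem HasLen2.one_add_tsum_sq {q lam : ℕ → ℝ} (h : IsGenSpec q lam) (hl : HasLen2 q lam) :
    1 + ∑' j, q j * lam j ^ 2 = 1 + lam 0 - (1 - lam 0) * (lam 0 - lam 1) := by
  obtain ⟨h0, -, -, -, -, -, hs⟩ := h
  rw [hl.tsum_mul_eq, h0] at hs
  rw [hl.tsum_mul_eq (fun j => lam j ^ 2), h0]
  linear_combination lam 1 * hs

theorem HasLen2.lam_zero_le_one {q lam : ℕ → ℝ} (h : IsGenSpec q lam) (hl : HasLen2 q lam) :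
    lam 0 ≤ 1 := by
  obtain ⟨h0, hq, -, -, hn, -, hs⟩ := h
  rw [hl.tsum_mul_eq, h0] at hs
  linarith [mul_nonneg (hq 1) (hn 1)]

theorem normalizer_pos {a d : ℝ} (ha : 0 < a) (hd : 0 ≤ d) (hda : d ≤ a) :
    0 < 1 + a - (1 - a) * d := by
  nlinarith [mul_nonneg ha.le hd]

theorem top_eigenvalue_mono {a d a' d' : ℝ} (ha' : 0 < a') (ha1 : a ≤ 1) (hd' : 0 ≤ d')
    (hda' : d' ≤ a') (hda : d ≤ a) (haa : a' ≤ a) (hdd : d' ≤ d) :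
    (a' + a' ^ 2) / (1 + a' - (1 - a') * d') ≤ (a + a ^ 2) / (1 + a - (1 - a) * d) := by
  have ha : 0 < a := ha'.trans_le haa
  have hD := normalizer_pos ha hd' (hda'.trans haa)
  trans (a + a ^ 2) / (1 + a - (1 - a) * d')
  · rw [div_le_div_iff₀ (normalizer_pos ha' hd' hda') hD]
    have : 0 ≤ (a - a') * ((1 + a + a') * (1 - d') + a * a' * (1 + d')) := by
      have : 0 ≤ a - a' := sub_nonneg.2 haa
      have : 0 ≤ 1 - d' := by linarith
      positivity
    linear_combination this
  · gcongr
    exact normalizer_pos ha (hd'.trans hdd) hda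

theorem gap_mono {a d a' d' : ℝ} (ha' : 0 < a') (ha1 : a ≤ 1) (hd' : 0 ≤ d')
    (hda' : d' ≤ a') (hda : d ≤ a) (haa : a' ≤ a) (hdd : d' ≤ d) :
    d' * (1 + 2 * a' - d') / (1 + a' - (1 - a') * d') ≤
      d * (1 + 2 * a - d) / (1 + a - (1 - a) * d) := by
  have ha : 0 < a := ha'.trans_le haa
  have hD := normalizer_pos ha hd' (hda'.trans haa)
  trans d' * (1 + 2 * a - d') / (1 + a - (1 - a) * d')
  · rw [div_le_div_iff₀ (normalizer_pos ha' hd' hda') hD]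
    have : 0 ≤ (a - a') * (d' * (1 - d') ^ 2) := by
      have : 0 ≤ a - a' := sub_nonneg.2 haa
      positivity
    linear_combination this
  · apply div_le_div₀
    · exact mul_nonneg (hd'.trans hdd) (by linarith)
    · have := mul_nonneg (sub_nonneg.2 hdd) (show 0 ≤ 1 + 2 * a - d - d' by linarith)
      linear_combination this
    · exact normalizer_pos ha (hd'.trans hdd) hda
    · gcongr

/-- on `𝒮`, `F` preserves the order `⪰`. -/
theorem stmt3 (q lam q' lam' : ℕ → ℝ)
    (h : IsGenSpec q lam) (h' : IsGenSpec q' lam')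
    (hl : HasLen2 q lam) (hl' : HasLen2 q' lam')
    (hord : Succeq lam lam') :
    Succeq (Fspec q lam) (Fspec q' lam') := by
  have ha1 := hl.lam_zero_le_one h
  have hgap' : lam' 1 < lam' 0 := h'.2.2.1
  have hb : 0 ≤ lam 1 := h.2.2.2.2.1 1
  have hb' : 0 ≤ lam' 1 := h'.2.2.2.2.1 1
  obtain ⟨haa, hdd⟩ := hord
  have ha' : 0 < lam' 0 := hb'.trans_lt hgap'
  have hd' : 0 ≤ lam' 0 - lam' 1 := by linarith
  have hda' : lam' 0 - lam' 1 ≤ lam' 0 := by linarith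
  have hda : lam 0 - lam 1 ≤ lam 0 := by linarith
  unfold Succeq Fspec
  rw [hl.one_add_tsum_sq h, hl'.one_add_tsum_sq h']
  refine ⟨top_eigenvalue_mono ha' ha1 hd' hda' hda haa hdd, ?_⟩
  rw [← sub_div, ← sub_div]
  convert gap_mono ha' ha1 hd' hda' hda haa hdd using 2 <;> ring
end
end

section
/- Let Λ be a generalized spectrum with λ_2 > 0. Then F(Λ) ⪰ F(S(Λ)). -/
noncomputable section

/-- The second moment of a generalized spectrum is at most that of `S(Λ)`. -/
theorem IsGenSpec.tsum_sq_le {q lam : ℕ → ℝ} (h : IsGenSpec q lam) :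
    ∑' j, q j * lam j ^ 2 ≤ lam 0 ^ 2 + lam 1 * (1 - lam 0) := by
  obtain ⟨hq0, hq, -, hmono, hlam, ⟨N, hN⟩, hsum⟩ := h
  have hsummable : ∀ f : ℕ → ℝ, Summable fun j => q j * f j := fun f =>
    summable_of_ne_finset_zero (s := Finset.range N) fun j hj => by
      rw [(hN j (by simpa using hj)).1, zero_mul]
  have hle : ∀ j, lam (j + 1) ≤ lam 1 := fun j => by
    induction j with
    | zero => rfl
    | succ j ih => exact (hmono (j + 1) (by omega)).trans ih
  rw [(hsummable lam).tsum_eq_zero_add, hq0, one_mul] at hsum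
  rw [(hsummable fun j => lam j ^ 2).tsum_eq_zero_add, hq0, one_mul, ← hsum,
    add_sub_cancel_left, ← tsum_mul_left]
  refine add_le_add_right (Summable.tsum_le_tsum (fun j => ?_)
    ((summable_nat_add_iff 1).2 (hsummable fun j => lam j ^ 2))
    (((summable_nat_add_iff 1).2 (hsummable lam)).mul_left _)) _
  nlinarith [mul_nonneg (mul_nonneg (hq (j + 1)) (hlam (j + 1))) (sub_nonneg.2 (hle j))]

theorem tsum_Sq_mul_Slam_sq {lam : ℕ → ℝ} (hpos : 0 < lam 1) :
    ∑' j, Sq lam j * Slam lam j ^ 2 = lam 0 ^ 2 + lam 1 * (1 - lam 0) := by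
  rw [tsum_eq_sum (s := Finset.range 2)]
  · simp only [Finset.sum_range_succ, Finset.sum_range_zero, Sq, Slam]
    norm_num
    field_simp
  · intro j hj
    have : 1 < j := by simpa using hj
    simp [Slam, show ¬ j ≤ 1 by omega]

/-- `F(Λ) ⪰ F(S(Λ))`. -/
theorem stmt4 (q lam : ℕ → ℝ) (h : IsGenSpec q lam) (hpos : 0 < lam 1) :
    Succeq (Fspec q lam) (Fspec (Sq lam) (Slam lam)) := by
  have hle := h.tsum_sq_le
  obtain ⟨-, hq, hlt, -, hlam, -, -⟩ := h
  have hnonneg : 0 ≤ ∑' j, q j * lam j ^ 2 := tsum_nonneg fun j => mul_nonneg (hq j) (sq_nonneg _)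
  have hnum : 0 ≤ lam 0 + lam 0 ^ 2 - (lam 1 + lam 1 ^ 2) := by nlinarith
  have hnum0 : 0 ≤ lam 0 + lam 0 ^ 2 := add_nonneg (hlam 0) (sq_nonneg _)
  simp only [Succeq, Fspec, tsum_Sq_mul_Slam_sq hpos, ← sub_div]
  simp only [Slam, zero_le, le_refl, if_true]
  constructor
  · gcongr
  · gcongr
end
end

section
/- Let d ≥ 2, λ ∈ V, Δ = λ_1 − λ_2, and ε > 0, and let n be a natural number. Then F^(n)(λ)_1 ≥ 1 − ε holds in each of the following cases: (i) Δ ≥ 2/3 and n ≥ log₂((1−λ_1)/((2Δ−1)ε)); (ii) 1/3 ≤ Δ < 2/3 and n ≥ log₂((1−λ_1)/((1−Δ)ε)) + 5; (iii) 0 < Δ < 1/3 and n ≥ log₂((1−λ_1)/((1−Δ)ε)) + 5 + f(λ_1,Δ), where f(λ_1,Δ) = min{ 1/Δ + 2·ln(1/Δ), ((1−λ_1)/λ_2 + 3)·ln(1 + λ_2/(Δ(1−Δ))) + 5·ln((1−Δ)/λ_2) } with λ_2 = λ_1 − Δ. -/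
open Finset

noncomputable section

/-- The spectral gap `λ₁ - λ₂`. -/
def gapV {d : ℕ} [NeZero d] (lam : Fin d → ℝ) : ℝ := lam 0 - lam 1

section OneStep

variable {d : ℕ} [NeZero d] {lam : Fin d → ℝ}

lemma memV.le_one_coord (h : memV lam) {i : Fin d} (hi : i ≠ 0) : lam i ≤ lam 1 := by
  refine h.2.1 1 i ?_
  have h0 : i.val ≠ 0 := fun h0 => hi (Fin.ext (by simpa using h0))
  rw [Fin.le_def]
  change 1 % d ≤ i.val
  exact (Nat.mod_le _ _).trans (by omega)

lemma memV.sum_erase (h : memV lam) : ∑ i ∈ univ.erase (0 : Fin d), lam i = 1 - lam 0 := by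
  have := Finset.add_sum_erase univ lam (mem_univ (0 : Fin d))
  rw [h.2.2.2] at this
  linarith

lemma memV.add_le_one (h : memV lam) : lam 0 + lam 1 ≤ 1 := by
  have h10 : (1 : Fin d) ≠ 0 := fun e => by
    have := h.2.2.1
    rw [e] at this
    exact lt_irrefl _ this
  have := Finset.single_le_sum (f := lam) (s := univ.erase (0 : Fin d))
    (fun i _ => h.1 i) (mem_erase.2 ⟨h10, mem_univ _⟩)
  rw [h.sum_erase] at this
  linarith

lemma memV.gap_pos (h : memV lam) : 0 < gapV lam := sub_pos.2 h.2.2.1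

lemma memV.gap_le_one (h : memV lam) : gapV lam ≤ 1 := by
  have := h.add_le_one
  have := h.1 1
  unfold gapV
  linarith

lemma memV.second_pos (h : memV lam) (hgap : gapV lam < 1) : 0 < lam 1 := by
  refine (h.1 1).lt_of_ne fun h1 => ?_
  have hz : ∑ i ∈ univ.erase (0 : Fin d), lam i = 0 := by
    refine Finset.sum_eq_zero fun i hi => le_antisymm ?_ (h.1 i)
    rw [h1]
    exact h.le_one_coord (mem_erase.1 hi).1
  rw [h.sum_erase] at hz
  unfold gapV at hgap
  linarith

/-- The tail `s = Σ_{j ≥ 2} λ_j²` of the squared norm is at most `λ₂ (1 - λ₁)`. -/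
lemma memV.exists_tail (h : memV lam) :
    ∃ s, 0 ≤ s ∧ s ≤ lam 1 * (1 - lam 0) ∧ ∑ j, lam j ^ 2 = lam 0 ^ 2 + s := by
  refine ⟨∑ j ∈ univ.erase (0 : Fin d), lam j ^ 2, Finset.sum_nonneg fun i _ => sq_nonneg _, ?_,
    (Finset.add_sum_erase univ (fun j => lam j ^ 2) (mem_univ (0 : Fin d))).symm⟩
  rw [← h.sum_erase, Finset.mul_sum]
  refine Finset.sum_le_sum fun i hi => ?_
  rw [sq]
  exact mul_le_mul_of_nonneg_right (h.le_one_coord (mem_erase.1 hi).1) (h.1 i)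

lemma memV.map (h : memV lam) : memV (Fmap lam) := by
  have hN : 0 < 1 + ∑ j, lam j ^ 2 := by positivity
  have h1 := h.1 1
  refine ⟨fun i => ?_, fun i j hij => ?_, ?_, ?_⟩
  · have := h.1 i
    unfold Fmap
    positivity
  · have := h.1 j
    have := h.1 i
    have := h.2.1 i j hij
    unfold Fmap
    gcongr
  · have := h.2.2.1
    unfold Fmap
    gcongr
  · unfold Fmap
    rw [← Finset.sum_div, div_eq_one_iff_eq hN.ne']
    simp only [mul_add, mul_one, Finset.sum_add_distrib, h.2.2.2, ← sq]
    ring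

lemma memV.iterate (h : memV lam) (n : ℕ) : memV (Fmap^[n] lam) := by
  induction n with
  | zero => exact h
  | succ n ih =>
    rw [Function.iterate_succ_apply']
    exact ih.map

/-- The quotient `(1 - λ₁) / (2Δ - 1)` halves. -/
lemma memV.eta_halving_step (h : memV lam) (hgap : 1 / 2 ≤ gapV lam) :
    2 * etaV (Fmap lam) * (2 * gapV lam - 1) ≤ etaV lam * (2 * gapV (Fmap lam) - 1) := by
  obtain ⟨s, hs0, hs, hsum⟩ := h.exists_tail
  have hy := h.1 1
  have hxy := h.2.2.1
  have hle := h.add_le_one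
  unfold gapV at hgap
  unfold etaV gapV Fmap
  rw [hsum]
  generalize lam 0 = x at *
  generalize lam 1 = y at *
  have hN : 0 < 1 + (x ^ 2 + s) := by positivity
  have e1 : 2 * (1 - x * (x + 1) / (1 + (x ^ 2 + s))) * (2 * (x - y) - 1) =
      2 * (1 - x + s) * (2 * (x - y) - 1) / (1 + (x ^ 2 + s)) := by
    field_simp
    ring
  have e2 : (1 - x) *
      (2 * (x * (x + 1) / (1 + (x ^ 2 + s)) - y * (y + 1) / (1 + (x ^ 2 + s))) - 1) =
      (1 - x) * (2 * (x - y) * (1 + x + y) - (1 + (x ^ 2 + s))) / (1 + (x ^ 2 + s)) := by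
    field_simp
    ring
  rw [e1, e2]
  refine div_le_div_of_nonneg_right ?_ hN.le
  have h1x : 0 ≤ 1 - x := by linarith
  have hcoef : 0 ≤ 2 * (2 * (x - y) - 1) + (1 - x) := by linarith
  have hrest : 0 ≤ (1 - x) * ((1 - x) ^ 2 + 3 * y * (1 - x) + 2 * y ^ 2) := by positivity
  linarith [mul_le_mul_of_nonneg_left hs hcoef]

/-- The quotient `(1 - λ₁) / λ₂` does not increase. -/
lemma memV.eta_mul_second_le (h : memV lam) :
    etaV (Fmap lam) * lam 1 ≤ etaV lam * Fmap lam 1 := by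
  obtain ⟨s, hs0, hs, hsum⟩ := h.exists_tail
  have hy := h.1 1
  have hxy := h.2.2.1
  have hle := h.add_le_one
  unfold etaV Fmap
  rw [hsum]
  generalize lam 0 = x at *
  generalize lam 1 = y at *
  have hN : 0 < 1 + (x ^ 2 + s) := by positivity
  have e : 1 - x * (x + 1) / (1 + (x ^ 2 + s)) = (1 - x + s) / (1 + (x ^ 2 + s)) := by
    field_simp
    ring
  rw [e, div_mul_eq_mul_div, ← mul_div_assoc]
  refine div_le_div_of_nonneg_right ?_ hN.le
  linarith [mul_le_mul_of_nonneg_right hs hy]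

/-- If `λ₂ ≥ c (1 - Δ)` with `c ≥ 0`, one step brings the gap at least to the value it would reach
if both this and `Σ_{j ≥ 2} λ_j² ≤ λ₂ (1 - λ₁)` were equalities. -/
lemma memV.gap_map_ge (h : memV lam) {c : ℝ} (hc0 : 0 ≤ c)
    (hc : c * (1 - gapV lam) ≤ lam 1) :
    gapV lam * (1 + gapV lam + 2 * (c * (1 - gapV lam))) /
      (1 + gapV lam ^ 2 + c * (1 - gapV lam) * (1 + gapV lam)) ≤ gapV (Fmap lam) := by
  obtain ⟨s, hs0, hs, hsum⟩ := h.exists_tail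
  have hΔ := h.gap_pos
  have hΔ1 := h.gap_le_one
  have hx : lam 0 = gapV lam + lam 1 := by unfold gapV; ring
  have e : gapV (Fmap lam) =
      gapV lam * (1 + gapV lam + 2 * lam 1) / (1 + (lam 0 ^ 2 + s)) := by
    rw [← hsum]
    unfold gapV Fmap
    ring
  rw [e, hx]
  rw [hx] at hs
  have hy := h.1 1
  generalize gapV lam = D at *
  generalize lam 1 = y at *
  have hz : 0 ≤ c * (1 - D) := mul_nonneg hc0 (by linarith)
  generalize c * (1 - D) = z at *
  have h2 : 1 + ((D + y) ^ 2 + s) ≤ 1 + D ^ 2 + y * (1 + D) := by nlinarith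
  calc D * (1 + D + 2 * z) / (1 + D ^ 2 + z * (1 + D))
      ≤ D * (1 + D + 2 * y) / (1 + D ^ 2 + y * (1 + D)) := by
        rw [div_le_div_iff₀ (by positivity) (by positivity), mul_assoc, mul_assoc]
        refine mul_le_mul_of_nonneg_left ?_ hΔ.le
        nlinarith [mul_nonneg (sub_nonneg.2 hc) (sq_nonneg (1 - D))]
    _ ≤ _ := by gcongr

lemma memV.gap_map_ge_simple (h : memV lam) :
    gapV lam * (1 + gapV lam) / (1 + gapV lam ^ 2) ≤ gapV (Fmap lam) := by
  simpa using h.gap_map_ge le_rfl (by simpa using h.1 1)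

/-- Below the threshold `1/3` the potential `1/Δ + 2 log (1/Δ) - 3Δ` drops by at least one. -/
lemma memV.potential_step (h : memV lam) (hlt : gapV lam < 1 / 3) :
    1 / gapV (Fmap lam) + 2 * Real.log (1 / gapV (Fmap lam)) - 3 * gapV (Fmap lam) ≤
      1 / gapV lam + 2 * Real.log (1 / gapV lam) - 3 * gapV lam - 1 := by
  have hD := h.gap_pos
  have hge := h.gap_map_ge_simple
  generalize gapV (Fmap lam) = E at *
  generalize gapV lam = D at *
  set g := D * (1 + D) / (1 + D ^ 2) with hg
  have hg0 : 0 < g := by positivity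
  have hmono : 1 / E + 2 * Real.log (1 / E) - 3 * E ≤
      1 / g + 2 * Real.log (1 / g) - 3 * g := by
    have : 0 < E := hg0.trans_le hge
    gcongr
  have ht : 0 ≤ D * (1 - D) / (1 + D ^ 2) := div_nonneg (by nlinarith) (by positivity)
  have hlog := Real.le_log_one_add_of_nonneg ht
  have e1 : 1 + D * (1 - D) / (1 + D ^ 2) = g / D := by
    rw [hg]
    field_simp
    ring
  rw [e1, Real.log_div hg0.ne' hD.ne'] at hlog
  have e2 : 2 * (D * (1 - D) / (1 + D ^ 2)) / (D * (1 - D) / (1 + D ^ 2) + 2) =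
      2 * D * (1 - D) / (2 + D + D ^ 2) := by
    have : (D * (1 - D) / (1 + D ^ 2) + 2) = (2 + D + D ^ 2) / (1 + D ^ 2) := by
      field_simp
      ring
    rw [this]
    field_simp
  have e3 : 1 / D - 1 / g = (1 - D) / (1 + D) := by
    rw [hg]
    field_simp
    ring
  have e4 : g - D = D ^ 2 * (1 - D) / (1 + D ^ 2) := by
    rw [hg]
    field_simp
    ring
  have key : 1 ≤ (1 - D) / (1 + D) + 2 * (2 * D * (1 - D) / (2 + D + D ^ 2)) +
      3 * (D ^ 2 * (1 - D) / (1 + D ^ 2)) := by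
    rw [← mul_div_assoc, ← mul_div_assoc, div_add_div _ _ (by positivity) (by positivity),
      div_add_div _ _ (by positivity) (by positivity), one_le_div (by positivity)]
    nlinarith [pow_pos hD 2, pow_pos hD 3, pow_pos hD 4, pow_pos hD 5,
      mul_pos (pow_pos hD 2) (sub_pos.2 hlt), mul_pos (pow_pos hD 3) (sub_pos.2 hlt),
      mul_pos (pow_pos hD 4) (sub_pos.2 hlt), mul_pos (pow_pos hD 5) (sub_pos.2 hlt)]
  rw [e2] at hlog
  have e5 : Real.log (1 / g) = -Real.log g := by rw [one_div, Real.log_inv]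
  have e6 : Real.log (1 / D) = -Real.log D := by rw [one_div, Real.log_inv]
  rw [e5] at hmono
  rw [e6]
  linarith

/-- Below the threshold `1/3`, and with `λ₂ ≥ c (1 - Δ)`, the potential
`(1/c + 2) log (1 + c/Δ) - 5 log (Δ + c)` drops by at least one. -/
lemma memV.potential_step_of_second_ge (h : memV lam) {c : ℝ} (hc0 : 0 < c) (hc2 : c ≤ 1 / 2)
    (hc : c * (1 - gapV lam) ≤ lam 1) (hlt : gapV lam < 1 / 3) :
    (1 / c + 2) * Real.log (1 + c / gapV (Fmap lam)) - 5 * Real.log (gapV (Fmap lam) + c) ≤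
      (1 / c + 2) * Real.log (1 + c / gapV lam) - 5 * Real.log (gapV lam + c) - 1 := by
  have hD := h.gap_pos
  have hge := h.gap_map_ge hc0.le hc
  generalize gapV (Fmap lam) = E at *
  generalize gapV lam = D at *
  clear hc
  set A := 1 + D ^ 2 + c * (1 - D) * (1 + D) with hA
  have h1D : 0 < 1 - D := by linarith
  have hA0 : 0 < A := by positivity
  set m := (1 - D) * (D + c * (1 - D)) / A with hm
  have hm0 : 0 < m := by positivity
  have eg : D * (1 + D + 2 * (c * (1 - D))) / A = D * (1 + m) := by
    rw [hm]
    field_simp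
    rw [hA]
    ring
  rw [eg] at hge
  have hg0 : 0 < D * (1 + m) := by positivity
  have hmono : (1 / c + 2) * Real.log (1 + c / E) - 5 * Real.log (E + c) ≤
      (1 / c + 2) * Real.log (1 + c / (D * (1 + m))) - 5 * Real.log (D * (1 + m) + c) := by
    have : 0 < E := hg0.trans_le hge
    gcongr
  have hlog1 := Real.le_log_one_add_of_nonneg
    (show 0 ≤ c * m / (D * (1 + m) + c) by positivity)
  have hlog2 := Real.le_log_one_add_of_nonneg (show 0 ≤ D * m / (D + c) by positivity)
  have e1 : 1 + c * m / (D * (1 + m) + c) = (1 + c / D) / (1 + c / (D * (1 + m))) := by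
    field_simp
    ring
  have e2 : 1 + D * m / (D + c) = (D * (1 + m) + c) / (D + c) := by
    field_simp
    ring
  rw [e1, Real.log_div (by positivity) (by positivity)] at hlog1
  rw [e2, Real.log_div (by positivity) (by positivity)] at hlog2
  set B := 2 * (D + c) + (2 * D + c) * m with hB
  have hB0 : 0 < B := by positivity
  have b1 : 2 * (c * m / (D * (1 + m) + c)) / (c * m / (D * (1 + m) + c) + 2) = 2 * c * m / B := by
    have : c * m / (D * (1 + m) + c) + 2 = B / (D * (1 + m) + c) := by
      rw [hB]
      field_simp
      ring
    rw [this]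
    field_simp
  have b2 : 2 * D * m / B ≤ 2 * (D * m / (D + c)) / (D * m / (D + c) + 2) := by
    have : D * m / (D + c) + 2 = (2 * (D + c) + D * m) / (D + c) := by
      field_simp
      ring
    have : 2 * (D * m / (D + c)) / (D * m / (D + c) + 2) = 2 * D * m / (2 * (D + c) + D * m) := by
      rw [this]
      field_simp
    rw [this]
    gcongr
    rw [hB]
    nlinarith [mul_pos hD hm0, mul_pos hc0 hm0]
  have key : 1 ≤ (1 / c + 2) * (2 * c * m / B) + 5 * (2 * D * m / B) := by
    have : (1 / c + 2) * (2 * c * m / B) + 5 * (2 * D * m / B) =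
        2 * m * (1 + 2 * c + 5 * D) / B := by
      field_simp
    rw [this, one_le_div hB0]
    have hmA : m * A = (1 - D) * (D + c * (1 - D)) := by
      rw [hm]
      field_simp
    refine le_of_mul_le_mul_right ?_ hA0
    have : 2 * (D + c) * A ≤ (m * A) * (2 + 3 * c + 8 * D) := by
      rw [hmA, hA]
      have h0 : 0 ≤ D ^ 2 * (6 - 10 * D) := mul_nonneg (sq_nonneg D) (by linarith)
      rcases le_total D (1 / 5) with h5 | h5
      · have h1 : 0 ≤ c ^ 2 * ((1 - D) * (1 - 5 * D)) :=
          mul_nonneg (sq_nonneg c) (mul_nonneg h1D.le (by linarith))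
        have h2 : 0 ≤ c * D * (5 - 19 * D + 10 * D ^ 2) :=
          mul_nonneg (by positivity) (by nlinarith)
        linarith
      · have h1 : 0 ≤ (1 - D) * (5 * D - 1) * (c * (1 / 2 - c)) :=
          mul_nonneg (mul_nonneg h1D.le (by linarith)) (mul_nonneg hc0.le (by linarith))
        have h2 : 0 ≤ 2 * c * (1 / 4 + D - 9 / 4 * D ^ 2 - 5 * D ^ 3) :=
          mul_nonneg (by positivity) (by nlinarith [mul_pos hD hD])
        have h3 := mul_nonneg (show 0 ≤ 1 - 2 * c by linarith) h0
        linarith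
    rw [hB]
    linarith
  have hm1 := mul_le_mul_of_nonneg_left (b1 ▸ hlog1) (show 0 ≤ 1 / c + 2 by positivity)
  have hm2 := b2.trans hlog2
  linarith

end OneStep

section Iterates

variable {d : ℕ} [NeZero d] {lam : Fin d → ℝ}

lemma memV.gap_le_gap_map (h : memV lam) : gapV lam ≤ gapV (Fmap lam) := by
  refine le_trans ?_ h.gap_map_ge_simple
  have := h.gap_pos
  have := h.gap_le_one
  rw [le_div_iff₀ (by positivity)]
  nlinarith

lemma memV.eta_nonneg (h : memV lam) : 0 ≤ etaV lam := by
  have := h.add_le_one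
  have := h.1 1
  unfold etaV
  linarith

/-- Once the gap exceeds `1/2`, the infidelity decays like `2⁻ⁿ`. -/
lemma memV.eta_iterate_le (h : memV lam) (hgap : 1 / 2 < gapV lam) (n : ℕ) :
    etaV (Fmap^[n] lam) ≤ etaV lam / (2 * gapV lam - 1) / 2 ^ n := by
  have key : ∀ n : ℕ, gapV lam ≤ gapV (Fmap^[n] lam) ∧
      etaV (Fmap^[n] lam) ≤
        etaV lam / (2 * gapV lam - 1) / 2 ^ n * (2 * gapV (Fmap^[n] lam) - 1) := by
    intro n
    induction n with
    | zero =>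
      refine ⟨le_rfl, le_of_eq ?_⟩
      have : 2 * gapV lam - 1 ≠ 0 := by linarith
      simp only [Function.iterate_zero, id, pow_zero, div_one]
      field_simp
    | succ n ih =>
      have hn := h.iterate n
      rw [Function.iterate_succ_apply']
      have hg := hn.gap_le_gap_map
      have hs := hn.eta_halving_step (hgap.le.trans ih.1)
      refine ⟨ih.1.trans hg, ?_⟩
      have hpos : 0 < 2 * gapV (Fmap^[n] lam) - 1 := by linarith [ih.1]
      have hpos' : 0 ≤ 2 * gapV (Fmap (Fmap^[n] lam)) - 1 := by linarith
      have := hs.trans (mul_le_mul_of_nonneg_right ih.2 hpos')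
      refine le_of_mul_le_mul_right ?_ (mul_pos two_pos hpos)
      rw [pow_succ, ← div_div]
      linarith
  obtain ⟨h1, h2⟩ := key n
  refine h2.trans (mul_le_of_le_one_right ?_ ?_)
  · have := h.eta_nonneg
    have : 0 < 2 * gapV lam - 1 := by linarith
    positivity
  · linarith [(h.iterate n).gap_le_one]

lemma memV.eta_iterate_mul_second_le (h : memV lam) (hy : 0 < lam 1) (n : ℕ) :
    0 < Fmap^[n] lam 1 ∧ etaV (Fmap^[n] lam) * lam 1 ≤ etaV lam * Fmap^[n] lam 1 := by
  induction n with
  | zero => exact ⟨hy, le_rfl⟩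
  | succ n ih =>
    have hn := h.iterate n
    have hs := hn.eta_mul_second_le
    rw [Function.iterate_succ_apply']
    obtain ⟨hp, hi⟩ := ih
    generalize Fmap^[n] lam = mu at *
    have hp' : 0 < Fmap mu 1 := by
      unfold Fmap
      positivity
    refine ⟨hp', le_of_mul_le_mul_right ?_ hp⟩
    nlinarith [mul_le_mul_of_nonneg_right hi hp'.le, mul_le_mul_of_nonneg_right hs hy.le]

lemma one_sub_gapV (lam : Fin d → ℝ) : 1 - gapV lam = etaV lam + lam 1 := by
  unfold gapV etaV
  ring

/-- The quotient `λ₂ / (1 - Δ)` does not decrease. -/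
lemma memV.second_iterate_ge (h : memV lam) (hy : 0 < lam 1) (n : ℕ) :
    lam 1 / (1 - gapV lam) * (1 - gapV (Fmap^[n] lam)) ≤ Fmap^[n] lam 1 := by
  obtain ⟨-, hi⟩ := h.eta_iterate_mul_second_le hy n
  rw [one_sub_gapV, one_sub_gapV]
  have := h.eta_nonneg
  rw [div_mul_eq_mul_div, div_le_iff₀ (by positivity)]
  linarith

/-- The quotient `(1 - λ₁) / (1 - Δ)` does not increase. -/
lemma memV.eta_iterate_le_one_sub_gap (h : memV lam) (hy : 0 < lam 1) (n : ℕ) :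
    etaV (Fmap^[n] lam) ≤ etaV lam / (1 - gapV lam) * (1 - gapV (Fmap^[n] lam)) := by
  obtain ⟨-, hi⟩ := h.eta_iterate_mul_second_le hy n
  rw [one_sub_gapV, one_sub_gapV]
  have := h.eta_nonneg
  rw [div_mul_eq_mul_div, le_div_iff₀ (by positivity)]
  linarith

/-- A gap of `1/3` grows to at least `2/3` in four steps. -/
lemma memV.gap_iterate_four (h : memV lam) (hgap : 1 / 3 ≤ gapV lam) :
    2 / 3 ≤ gapV (Fmap^[4] lam) := by
  have step : ∀ a b : ℝ, 0 < a → b < 1 → b * (1 + a ^ 2) ≤ a * (1 + a) →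
      ∀ mu : Fin d → ℝ, memV mu → a ≤ gapV mu → b ≤ gapV (Fmap mu) := by
    intro a b ha hb hab mu hmu hge
    refine le_trans ?_ hmu.gap_map_ge_simple
    rw [le_div_iff₀ (by positivity)]
    nlinarith [mul_nonneg (sub_nonneg.2 hge) (by linarith [hmu.gap_pos] : 0 ≤ gapV mu + a),
      mul_nonneg (mul_nonneg (sub_nonneg.2 hge) (by linarith [hmu.gap_pos] : 0 ≤ gapV mu + a))
        (sub_nonneg.2 hb.le)]
  have h1 := step (1 / 3) (2 / 5) (by norm_num) (by norm_num) (by norm_num) _ h hgap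
  have h2 := step _ (12 / 25) (by norm_num) (by norm_num) (by norm_num) _ (h.iterate 1) h1
  have h3 := step _ (57 / 100) (by norm_num) (by norm_num) (by norm_num) _ (h.iterate 2) h2
  exact step _ (2 / 3) (by norm_num) (by norm_num) (by norm_num) _ (h.iterate 3) h3

/-- If the gap has reached `1/3` after `k` steps, then after `n` steps the infidelity is at most
`2 ^ (k + 4 - n)` times `(1 - λ₁) / (1 - Δ)`. -/
lemma memV.eta_iterate_le_of_gap (h : memV lam) (hy : 0 < lam 1) {k : ℕ}
    (hk : 1 / 3 ≤ gapV (Fmap^[k] lam)) (n : ℕ) :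
    etaV (Fmap^[n] lam) ≤ etaV lam / (1 - gapV lam) * (2 : ℝ) ^ ((k : ℝ) + 4 - n) := by
  have hR : 0 ≤ etaV lam / (1 - gapV lam) :=
    div_nonneg h.eta_nonneg (sub_nonneg.2 h.gap_le_one)
  rcases le_total n (k + 4) with hn | hn
  · refine (h.eta_iterate_le_one_sub_gap hy n).trans (mul_le_mul_of_nonneg_left ?_ hR)
    have h1 : (1 : ℝ) ≤ 2 ^ ((k : ℝ) + 4 - n) := by
      refine Real.one_le_rpow one_le_two ?_
      have : (n : ℝ) ≤ k + 4 := by exact_mod_cast hn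
      linarith
    linarith [(h.iterate n).gap_pos]
  · obtain ⟨j, rfl⟩ := Nat.exists_eq_add_of_le hn
    have h4 := (h.iterate k).gap_iterate_four hk
    rw [← Function.iterate_add_apply] at h4
    have hb := (h.iterate (4 + k)).eta_iterate_le (by linarith) j
    rw [← Function.iterate_add_apply] at hb
    have hc := h.eta_iterate_le_one_sub_gap hy (4 + k)
    rw [show k + 4 + j = j + (4 + k) by ring]
    have e : (2 : ℝ) ^ ((k : ℝ) + 4 - ((j + (4 + k) : ℕ) : ℝ)) = 1 / 2 ^ j := by
      rw [show (k : ℝ) + 4 - ((j + (4 + k) : ℕ) : ℝ) = -(j : ℝ) by push_cast; ring,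
        Real.rpow_neg two_pos.le, Real.rpow_natCast, one_div]
    rw [e, mul_one_div]
    refine hb.trans (div_le_div_of_nonneg_right ?_ (by positivity))
    have hpos : 0 < 2 * gapV (Fmap^[4 + k] lam) - 1 := by linarith
    rw [div_le_iff₀ hpos]
    exact hc.trans (mul_le_mul_of_nonneg_left (by linarith) hR)

/-- A nonnegative potential dropping by one at every step bounds the number of steps needed to
leave the region where it does so. -/
lemma exists_index_of_potential {α : Type*} (u : ℕ → α) (p : α → Prop) (φ : α → ℝ)
    (hφ : ∀ n, ¬ p (u n) → 0 ≤ φ (u n))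
    (hstep : ∀ n, ¬ p (u n) → φ (u (n + 1)) ≤ φ (u n) - 1) {M : ℝ} (hM : 0 ≤ M)
    (h0 : φ (u 0) ≤ M) : ∃ k : ℕ, p (u k) ∧ (k : ℝ) ≤ M + 1 := by
  by_contra! hcon
  have hlt : ∀ j : ℕ, (j : ℝ) ≤ M + 1 → ¬ p (u j) := fun j hj hp => (hcon j hp).not_ge hj
  have hdec : ∀ j : ℕ, (j : ℝ) ≤ M + 1 → φ (u j) ≤ M - j := by
    intro j
    induction j with
    | zero => intro _; simpa using h0
    | succ j ih =>
      intro hj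
      push_cast at hj ⊢
      have := hstep j (hlt j (by linarith))
      linarith [ih (by linarith)]
  have hfl : ((⌊M⌋₊ + 1 : ℕ) : ℝ) ≤ M + 1 := by
    push_cast
    linarith [Nat.floor_le hM]
  have h1 := hdec _ hfl
  have h2 := hφ _ (hlt _ hfl)
  have h3 := Nat.lt_floor_add_one M
  push_cast at h1
  linarith

lemma memV.exists_gap_ge_third (h : memV lam) (hlt : gapV lam < 1 / 3) :
    ∃ k : ℕ, 1 / 3 ≤ gapV (Fmap^[k] lam) ∧
      (k : ℝ) ≤ 1 / gapV lam + 2 * Real.log (1 / gapV lam) + 1 := by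
  have hD := h.gap_pos
  have hlog : ∀ D : ℝ, 0 < D → D < 1 / 3 → 0 ≤ Real.log (1 / D) := fun D h0 h1 =>
    Real.log_nonneg (by rw [le_div_iff₀ h0]; linarith)
  refine exists_index_of_potential (fun k => Fmap^[k] lam) (fun mu => 1 / 3 ≤ gapV mu)
    (fun mu => 1 / gapV mu + 2 * Real.log (1 / gapV mu) - 3 * gapV mu)
    (fun n hn => ?_) (fun n hn => ?_) ?_ ?_
  · have h0 := (h.iterate n).gap_pos
    have h1 := not_le.1 hn
    have h2 := hlog _ h0 h1
    have h3 : 1 ≤ 1 / gapV (Fmap^[n] lam) := by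
      rw [le_div_iff₀ h0]
      linarith
    linarith
  · simp only [Function.iterate_succ_apply']
    exact (h.iterate n).potential_step (not_le.1 hn)
  · have := hlog _ hD hlt
    positivity
  · simp only [Function.iterate_zero, id]
    linarith

lemma memV.exists_gap_ge_third' (h : memV lam) (hlt : gapV lam < 1 / 3) :
    ∃ k : ℕ, 1 / 3 ≤ gapV (Fmap^[k] lam) ∧
      (k : ℝ) ≤ ((1 - lam 0) / lam 1 + 3) *
          Real.log (1 + lam 1 / (gapV lam * (1 - gapV lam))) +
        5 * Real.log ((1 - gapV lam) / lam 1) + 1 := by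
  have hD := h.gap_pos
  have hy := h.second_pos (by linarith)
  have h1D : 0 < 1 - gapV lam := by linarith
  set c := lam 1 / (1 - gapV lam) with hc
  have hc0 : 0 < c := by positivity
  have hc2 : c ≤ 1 / 2 := by
    rw [hc, div_le_iff₀ h1D]
    have := h.add_le_one
    unfold gapV
    linarith
  have e1 : (1 - lam 0) / lam 1 + 3 = 1 / c + 2 := by
    rw [hc, one_div_div, one_sub_gapV]
    unfold etaV
    field_simp
    ring
  have e2 : lam 1 / (gapV lam * (1 - gapV lam)) = c / gapV lam := by
    rw [hc, div_div, mul_comm]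
  have e3 : Real.log ((1 - gapV lam) / lam 1) = -Real.log c := by
    rw [← Real.log_inv, hc, inv_div]
  rw [e1, e2, e3]
  refine exists_index_of_potential (fun k => Fmap^[k] lam) (fun mu => 1 / 3 ≤ gapV mu)
    (fun mu => (1 / c + 2) * Real.log (1 + c / gapV mu) - 5 * Real.log (gapV mu + c))
    (fun n hn => ?_) (fun n hn => ?_) ?_ ?_
  · have h0 := (h.iterate n).gap_pos
    have h1 := not_le.1 hn
    have h2 : Real.log (gapV (Fmap^[n] lam) + c) ≤ 0 :=
      Real.log_nonpos (by linarith) (by linarith)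
    have h3 : 0 ≤ Real.log (1 + c / gapV (Fmap^[n] lam)) :=
      Real.log_nonneg (by linarith [div_pos hc0 h0])
    have h4 : 0 ≤ (1 / c + 2) * Real.log (1 + c / gapV (Fmap^[n] lam)) := by positivity
    linarith
  · simp only [Function.iterate_succ_apply']
    exact (h.iterate n).potential_step_of_second_ge hc0 hc2 (h.second_iterate_ge hy n)
      (not_le.1 hn)
  · have h2 : Real.log c ≤ 0 := Real.log_nonpos hc0.le (by linarith)
    have h3 : 0 ≤ Real.log (1 + c / gapV lam) := Real.log_nonneg (by linarith [div_pos hc0 hD])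
    have h4 : 0 ≤ (1 / c + 2) * Real.log (1 + c / gapV lam) := by positivity
    linarith
  · have : Real.log c ≤ Real.log (gapV lam + c) := Real.log_le_log hc0 (by linarith)
    simp only [Function.iterate_zero, id]
    linarith

lemma memV.eta_iterate_le_of_logb_le (h : memV lam) (hgap : gapV lam < 1) {ε : ℝ} (hε : 0 < ε)
    {k n : ℕ} (hk : 1 / 3 ≤ gapV (Fmap^[k] lam))
    (hn : Real.logb 2 (etaV lam / ((1 - gapV lam) * ε)) + (k + 4) ≤ n) :
    etaV (Fmap^[n] lam) ≤ ε := by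
  have hy := h.second_pos hgap
  have h1D : 0 < 1 - gapV lam := by linarith
  have hη : 0 < etaV lam := by
    have := h.add_le_one
    unfold etaV
    linarith
  have hle : Real.logb 2 (etaV lam / ((1 - gapV lam) * ε)) ≤ (n : ℝ) - (k + 4) := by linarith
  rw [Real.logb_le_iff_le_rpow one_lt_two (by positivity), ← div_div, div_le_iff₀ hε] at hle
  refine (h.eta_iterate_le_of_gap hy hk n).trans ?_
  calc _ ≤ (2 : ℝ) ^ ((n : ℝ) - (k + 4)) * ε * 2 ^ ((k : ℝ) + 4 - n) := by gcongr
    _ = (2 : ℝ) ^ ((n : ℝ) - (k + 4) + ((k : ℝ) + 4 - n)) * ε := by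
      rw [Real.rpow_add two_pos]
      ring
    _ = ε := by
      rw [show (n : ℝ) - (k + 4) + ((k : ℝ) + 4 - n) = 0 by ring, Real.rpow_zero, one_mul]

end Iterates

/-- sufficient number of levels of the recursive swap test to reach
principal eigenvalue at least `1 - ε`, in each of the three regimes for the gap `Δ`. -/
theorem stmt6 (d : ℕ) [NeZero d] (hd : 2 ≤ d) (lam : Fin d → ℝ) (hV : memV lam)
    (Δ ε : ℝ) (hΔ : Δ = lam 0 - lam 1) (hε : 0 < ε) (n : ℕ)
    (hcase :
      (2/3 ≤ Δ ∧ Real.logb 2 ((1 - lam 0) / ((2*Δ - 1) * ε)) ≤ (n : ℝ)) ∨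
      (1/3 ≤ Δ ∧ Δ < 2/3 ∧
        Real.logb 2 ((1 - lam 0) / ((1 - Δ) * ε)) + 5 ≤ (n : ℝ)) ∨
      (0 < Δ ∧ Δ < 1/3 ∧
        Real.logb 2 ((1 - lam 0) / ((1 - Δ) * ε)) + 5 +
          min (1/Δ + 2 * Real.log (1/Δ))
            (((1 - lam 0) / lam 1 + 3) * Real.log (1 + lam 1 / (Δ * (1 - Δ))) +
              5 * Real.log ((1 - Δ) / lam 1)) ≤ (n : ℝ))) :
    1 - ε ≤ Fmap^[n] lam 0 := by
  suffices hs : etaV (Fmap^[n] lam) ≤ ε by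
    unfold etaV at hs
    linarith
  change Δ = gapV lam at hΔ
  subst hΔ
  change (_ ∧ Real.logb 2 (etaV lam / _) ≤ _) ∨ (_ ∧ _ ∧ Real.logb 2 (etaV lam / _) + _ ≤ _) ∨
    (_ ∧ _ ∧ Real.logb 2 (etaV lam / _) + _ + _ ≤ _) at hcase
  rcases hcase with ⟨hgap, hn⟩ | ⟨hlo, hhi, hn⟩ | ⟨-, hlt, hn⟩
  · have hpos : 0 < 2 * gapV lam - 1 := by linarith
    refine (hV.eta_iterate_le (by linarith) n).trans ?_
    rcases hV.eta_nonneg.eq_or_lt with h0 | h0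
    · simpa [← h0] using hε.le
    · rw [Real.logb_le_iff_le_rpow one_lt_two (by positivity), Real.rpow_natCast, ← div_div,
        div_le_iff₀ hε] at hn
      rw [div_le_iff₀ (by positivity)]
      linarith
  · refine hV.eta_iterate_le_of_logb_le (k := 0) (by linarith) hε hlo ?_
    push_cast
    linarith
  · have hlt1 : gapV lam < 1 := by linarith
    rcases min_choice (1 / gapV lam + 2 * Real.log (1 / gapV lam))
      (((1 - lam 0) / lam 1 + 3) * Real.log (1 + lam 1 / (gapV lam * (1 - gapV lam))) +
        5 * Real.log ((1 - gapV lam) / lam 1)) with hm | hm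
    · rw [hm] at hn
      obtain ⟨k, hk, hkle⟩ := hV.exists_gap_ge_third hlt
      exact hV.eta_iterate_le_of_logb_le hlt1 hε hk (by linarith)
    · rw [hm] at hn
      obtain ⟨k, hk, hkle⟩ := hV.exists_gap_ge_third' hlt
      exact hV.eta_iterate_le_of_logb_le hlt1 hε hk (by linarith)
end
end

section
/- Let d ≥ 2, λ ∈ V, λ' = F(λ), and 2 ≤ j ≤ d. Then γ_j(λ') = γ_j(λ)·(1 + λ_j)/(1 + λ_1 + λ_j), and moreover γ_j(λ') ≤ γ_j(λ)·exp(−1/(1/λ_1 + 3/2)). -/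
open Finset

noncomputable section

/-- `γ_j(λ) = λ_j/(λ_1 - λ_j)` (zero-indexed). -/
def gamV {d : ℕ} [NeZero d] (lam : Fin d → ℝ) (j : Fin d) : ℝ :=
  lam j / (lam 0 - lam j)

/-- For `0 ≤ b ≤ a` and `0 < a`, the ratio `(1 + b) / (1 + a + b)` decays exponentially
at rate at least `1 / (1 / a + 3 / 2)`. -/
theorem one_add_div_le_exp_neg {a b : ℝ} (ha : 0 < a) (hb : 0 ≤ b) (hba : b ≤ a) :
    (1 + b) / (1 + a + b) ≤ Real.exp (-(1 / (1 / a + 3/2))) := by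
  have hx : 0 < a / (1 + b) := by positivity
  have hlog := Real.le_log_one_add_of_nonneg hx.le
  have hrate : 1 / (1 / a + 3/2) ≤ 2 * (a / (1 + b)) / (a / (1 + b) + 2) := by
    have h1 : 1 / (1 / a + 3/2) = 2 * a / (2 + 3 * a) := by field_simp
    have h2 : 2 * (a / (1 + b)) / (a / (1 + b) + 2) = 2 * a / (a + 2 * (1 + b)) := by
      field_simp
    rw [h1, h2]
    gcongr 2 * a / ?_
    linarith
  have hratio : (1 + b) / (1 + a + b) = Real.exp (-Real.log (1 + a / (1 + b))) := by
    rw [Real.exp_neg, Real.exp_log (by positivity)]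
    field_simp
    ring
  rw [hratio]
  exact Real.exp_le_exp.mpr (neg_le_neg (hrate.trans hlog))

/-- The exact effect of `Fmap` on `gamV`. -/
theorem gamV_Fmap {d : ℕ} [NeZero d] (lam : Fin d → ℝ) (j : Fin d) :
    gamV (Fmap lam) j = gamV lam j * ((1 + lam j) / (1 + lam 0 + lam j)) := by
  have hN : 1 + ∑ i, lam i ^ 2 ≠ 0 := by positivity
  unfold gamV Fmap
  rw [← sub_div, div_div_div_cancel_right₀ hN, div_mul_div_comm]
  congr 1 <;> ring

/-- exact one-step formula for `γ_j` and its geometric decay. -/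
theorem stmt8 (d : ℕ) [NeZero d] (hd : 2 ≤ d) (lam : Fin d → ℝ) (hV : memV lam)
    (j : Fin d) (hj : j ≠ 0) :
    gamV (Fmap lam) j = gamV lam j * ((1 + lam j) / (1 + lam 0 + lam j)) ∧
    gamV (Fmap lam) j ≤ gamV lam j * Real.exp (-(1 / (1 / lam 0 + 3/2))) := by
  have hstep := gamV_Fmap lam j
  obtain ⟨hnonneg, hanti, hgap, -⟩ := hV
  have h1j : (1 : Fin d) ≤ j := by
    have hj' : (j : ℕ) ≠ 0 := fun h => hj (Fin.ext (by simpa using h))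
    rw [Fin.le_def, Fin.val_one', Nat.mod_eq_of_lt (by omega)]
    omega
  have hlt : lam j < lam 0 := (hanti 1 j h1j).trans_lt hgap
  refine ⟨hstep, hstep.le.trans ?_⟩
  exact mul_le_mul_of_nonneg_left
    (one_add_div_le_exp_neg ((hnonneg j).trans_lt hlt) (hnonneg j) hlt.le)
    (div_nonneg (hnonneg j) (sub_nonneg.mpr hlt.le))
end
end

section
/- Let d ≥ 2 and λ ∈ V, and set λ' = F(λ). Then E(λ') ≤ E(λ)·exp(−1/(1/λ_1 + 3/2)). -/
open Finset

noncomputable section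

/-- The contraction factor of a single term `y / (x - y)` of `E` under one step of `F`. -/
theorem one_add_div_one_add_add_le_exp {x y : ℝ} (hx : 0 < x) (hy : 0 ≤ y) (hyx : y ≤ x) :
    (1 + y) / (1 + x + y) ≤ Real.exp (-(1 / (1 / x + 3 / 2))) := by
  have hlog := Real.le_log_one_add_of_nonneg (x := x / (1 + y)) (by positivity)
  have hcmp : 1 / (1 / x + 3 / 2) ≤ 2 * (x / (1 + y)) / (x / (1 + y) + 2) := by
    have h1 : 1 / (1 / x + 3 / 2) = 2 * x / (2 + 3 * x) := by field_simp
    have h2 : 2 * (x / (1 + y)) / (x / (1 + y) + 2) = 2 * x / (x + 2 * (1 + y)) := by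
      field_simp
    rw [h1, h2]
    exact div_le_div_of_nonneg_left (by positivity) (by positivity) (by linarith)
  have heq : (1 + y) / (1 + x + y) = (1 + x / (1 + y))⁻¹ := by
    field_simp
    ring
  rw [heq, Real.exp_neg]
  gcongr
  rw [← Real.le_log_iff_exp_le (by positivity)]
  exact hcmp.trans hlog

/-- The leading entry of a valid spectrum strictly dominates all the others. -/
theorem memV.lt_zero {d : ℕ} [NeZero d] (hd : 2 ≤ d) {lam : Fin d → ℝ} (hV : memV lam)
    {j : Fin d} (hj : j ≠ 0) : lam j < lam 0 := by
  refine (hV.2.1 1 j ?_).trans_lt hV.2.2.1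
  have hj' : (j : ℕ) ≠ 0 := fun h => hj (Fin.ext (by simpa using h))
  rw [Fin.le_def, Fin.coe_ofNat_eq_mod, Nat.mod_eq_of_lt (by omega)]
  omega

/-- one-step geometric decay of `E` in terms of `λ₁`. -/
theorem stmt9 (d : ℕ) [NeZero d] (hd : 2 ≤ d) (lam : Fin d → ℝ) (hV : memV lam) :
    Evec (Fmap lam) ≤ Evec lam * Real.exp (-(1 / (1 / lam 0 + 3/2))) := by
  unfold Evec
  rw [Finset.sum_mul]
  refine Finset.sum_le_sum fun j hj => ?_
  have hlt := hV.lt_zero hd (Finset.ne_of_mem_erase hj)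
  have hj0 := hV.1 j
  have hpos : 0 < lam 0 := hj0.trans_lt hlt
  have hsub : 0 < lam 0 - lam j := sub_pos.mpr hlt
  have hnorm : 0 < 1 + ∑ i, lam i ^ 2 := by positivity
  have hterm : Fmap lam j / (Fmap lam 0 - Fmap lam j) =
      lam j / (lam 0 - lam j) * ((1 + lam j) / (1 + lam 0 + lam j)) := by
    have hfac : Fmap lam 0 - Fmap lam j =
        (lam 0 - lam j) * (1 + lam 0 + lam j) / (1 + ∑ i, lam i ^ 2) := by
      simp only [Fmap]
      ring
    rw [hfac, Fmap, div_div_div_cancel_right₀ hnorm.ne', div_mul_div_comm, add_comm (lam j) 1]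
  rw [hterm]
  exact mul_le_mul_of_nonneg_left (one_add_div_one_add_add_le_exp hpos hj0 hlt.le)
    (by positivity)
end
end

section
/- Let d ≥ 2 and λ ∈ V. Then either E(λ) ≤ 1/λ_1, or there exists a natural number l₁ with l₁ ≤ ⌈(1/λ_1 + 3/2)·ln(E(λ)·λ_1)⌉ such that E(F^(l₁)(λ)) ≤ 1/λ_1. -/
open Finset

noncomputable section

/-- Probability vectors whose entry at `0` is strictly larger than all the others. -/
def IsDominated {d : ℕ} [NeZero d] (lam : Fin d → ℝ) : Prop :=
  (∀ i, 0 ≤ lam i) ∧ (∀ i, i ≠ 0 → lam i < lam 0) ∧ ∑ i, lam i = 1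

theorem memV.isDominated {d : ℕ} [NeZero d] {lam : Fin d → ℝ} (h : memV lam) :
    IsDominated lam := by
  refine ⟨h.1, fun i hi => lt_of_le_of_lt (h.2.1 1 i ?_) h.2.2.1, h.2.2.2⟩
  exact Fin.one_le_of_ne_zero hi

namespace IsDominated

variable {d : ℕ} [NeZero d] {lam : Fin d → ℝ}

theorem le_zero (h : IsDominated lam) (i : Fin d) : lam i ≤ lam 0 := by
  rcases eq_or_ne i 0 with rfl | hi
  · exact le_rfl
  · exact (h.2.1 i hi).le

theorem zero_pos (h : IsDominated lam) : 0 < lam 0 := by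
  by_contra! h0
  have : ∑ i, lam i ≤ 0 := Finset.sum_nonpos fun i _ => (h.le_zero i).trans h0
  linarith [h.2.2]

theorem sum_sq_le (h : IsDominated lam) : ∑ i, lam i ^ 2 ≤ lam 0 := by
  calc ∑ i, lam i ^ 2 ≤ ∑ i, lam 0 * lam i :=
        Finset.sum_le_sum fun i _ => by
          rw [sq]; exact mul_le_mul_of_nonneg_right (h.le_zero i) (h.1 i)
    _ = lam 0 := by rw [← Finset.mul_sum, h.2.2, mul_one]

theorem fmap (h : IsDominated lam) : IsDominated (Fmap lam) := by
  have hS : 0 < 1 + ∑ j, lam j ^ 2 := by positivity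
  refine ⟨fun i => ?_, fun i hi => ?_, ?_⟩
  · have := h.1 i
    unfold Fmap
    positivity
  · have h1 := h.2.1 i hi
    have h2 := h.1 i
    unfold Fmap
    gcongr
  · unfold Fmap
    rw [← Finset.sum_div, div_eq_one_iff_eq hS.ne']
    simp_rw [mul_add, mul_one, ← sq]
    rw [Finset.sum_add_distrib, h.2.2, add_comm]

theorem le_fmap_zero (h : IsDominated lam) : lam 0 ≤ Fmap lam 0 := by
  have hS : 0 < 1 + ∑ j, lam j ^ 2 := by positivity
  unfold Fmap
  rw [le_div_iff₀ hS]
  have := mul_le_mul_of_nonneg_left h.sum_sq_le h.zero_pos.le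
  linarith

theorem evec_fmap_le (h : IsDominated lam) {a : ℝ} (ha : 0 ≤ a) (ha' : a ≤ lam 0) :
    Evec (Fmap lam) ≤ (1 + a) / (1 + 2 * a) * Evec lam := by
  have hS : 0 < 1 + ∑ j, lam j ^ 2 := by positivity
  unfold Evec
  rw [Finset.mul_sum]
  refine Finset.sum_le_sum fun j hj => ?_
  have hlt := h.2.1 j (Finset.ne_of_mem_erase hj)
  have hj0 := h.1 j
  have hsub : 0 < lam 0 - lam j := sub_pos.2 hlt
  have hden : 0 < 1 + lam 0 + lam j := by linarith
  have hratio : (1 + lam j) / (1 + lam 0 + lam j) ≤ (1 + a) / (1 + 2 * a) := by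
    rw [div_le_div_iff₀ hden (by linarith)]
    nlinarith [mul_nonneg (ha.trans ha') (sub_nonneg.2 hlt.le), mul_nonneg ha hsub.le]
  have hterm : Fmap lam j / (Fmap lam 0 - Fmap lam j) =
      (1 + lam j) / (1 + lam 0 + lam j) * (lam j / (lam 0 - lam j)) := by
    unfold Fmap
    rw [← sub_div, div_div_div_cancel_right₀ hS.ne', div_mul_div_comm]
    congr 1 <;> ring
  rw [hterm]
  exact mul_le_mul_of_nonneg_right hratio (div_nonneg hj0 hsub.le)

theorem iterate (h : IsDominated lam) (k : ℕ) :
    IsDominated (Fmap^[k] lam) ∧ lam 0 ≤ (Fmap^[k] lam) 0 ∧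
      Evec (Fmap^[k] lam) ≤ ((1 + lam 0) / (1 + 2 * lam 0)) ^ k * Evec lam := by
  have ha := h.zero_pos
  induction k with
  | zero => simp [h]
  | succ k ih =>
    obtain ⟨hk, h0, hE⟩ := ih
    rw [Function.iterate_succ_apply']
    refine ⟨hk.fmap, h0.trans hk.le_fmap_zero, (hk.evec_fmap_le ha.le h0).trans ?_⟩
    rw [pow_succ', mul_assoc]
    gcongr

end IsDominated

/-- The contraction rate over one step, compared with an exponential rate. -/
theorem log_rate_ge {a : ℝ} (ha : 0 < a) :
    1 ≤ (1 / a + 3 / 2) * Real.log ((1 + 2 * a) / (1 + a)) := by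
  have hlog := Real.le_log_one_add_of_nonneg (x := a / (1 + a)) (by positivity)
  have h1 : 1 + a / (1 + a) = (1 + 2 * a) / (1 + a) := by field_simp; ring
  have h2 : 2 * (a / (1 + a)) / (a / (1 + a) + 2) = 1 / (1 / a + 3 / 2) := by
    field_simp; ring
  rw [h1, h2, div_le_iff₀' (by positivity)] at hlog
  exact hlog

/-- length of the first stage. -/
theorem stmt10 (d : ℕ) [NeZero d] (hd : 2 ≤ d) (lam : Fin d → ℝ) (hV : memV lam) :
    Evec lam ≤ 1 / lam 0 ∨
      ∃ l₁ : ℕ, (l₁ : ℤ) ≤ ⌈(1 / lam 0 + 3/2) * Real.log (Evec lam * lam 0)⌉ ∧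
        Evec (Fmap^[l₁] lam) ≤ 1 / lam 0 := by
  have h := hV.isDominated
  have ha := h.zero_pos
  refine or_iff_not_imp_left.2 fun hE => ?_
  rw [not_le, div_lt_iff₀ ha] at hE
  have hL : 0 < Real.log (Evec lam * lam 0) := Real.log_pos hE
  set c : ℝ := 1 / lam 0 + 3 / 2 with hc
  have hc0 : 0 < c := by positivity
  have hceil : 0 ≤ ⌈c * Real.log (Evec lam * lam 0)⌉ := Int.ceil_nonneg (by positivity)
  obtain ⟨l, hl⟩ := Int.eq_ofNat_of_zero_le hceil
  refine ⟨l, hl.ge, (h.iterate l).2.2.trans ?_⟩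
  have hle : c * Real.log (Evec lam * lam 0) ≤ (l : ℝ) := by
    have := Int.le_ceil (c * Real.log (Evec lam * lam 0))
    rw [hl] at this
    exact_mod_cast this
  set q : ℝ := (1 + 2 * lam 0) / (1 + lam 0) with hq
  have hq0 : 0 < q := by positivity
  have hrate : 1 ≤ c * Real.log q := log_rate_ge ha
  have hlog : Real.log (Evec lam * lam 0) ≤ Real.log (q ^ l) := by
    rw [Real.log_pow]
    have hq1 : 0 ≤ Real.log q := by
      by_contra! hneg
      linarith [mul_neg_of_pos_of_neg hc0 hneg]
    calc Real.log (Evec lam * lam 0)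
        ≤ Real.log (Evec lam * lam 0) * (c * Real.log q) := le_mul_of_one_le_right hL.le hrate
      _ = c * Real.log (Evec lam * lam 0) * Real.log q := by ring
      _ ≤ l * Real.log q := mul_le_mul_of_nonneg_right hle hq1
  have hpow : Evec lam * lam 0 ≤ q ^ l :=
    (Real.log_le_log_iff (by linarith) (by positivity)).1 hlog
  rw [← inv_div, ← hq, inv_pow, le_div_iff₀ ha, mul_assoc, inv_mul_le_iff₀ (by positivity), mul_one]
  exact hpow
end
end

section
/- Let d ≥ 2 and λ ∈ V satisfy λ_2/(λ_1 − λ_2) ≤ 1 and E(λ) ≥ 1/2. Then there exists a natural number l₂ with l₂ ≤ 2·E(λ)·ln 2 + (1 + (5/2)·ln 2)·⌈1 + ln(E(λ))/ln 2⌉ such that E(F^(l₂)(λ)) ≤ 1/2. -/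
open Finset

noncomputable section

/-- Probability vectors whose leading entry is at least twice every other entry. -/
def HasDominantHead {d : ℕ} [NeZero d] (lam : Fin d → ℝ) : Prop :=
  (∀ i, 0 ≤ lam i) ∧ ∑ i, lam i = 1 ∧ 0 < lam 0 ∧ ∀ j, j ≠ 0 → 2 * lam j ≤ lam 0

lemma memV.hasDominantHead {d : ℕ} [NeZero d] (hd : 2 ≤ d) {lam : Fin d → ℝ} (hV : memV lam)
    (hγ : lam 1 / (lam 0 - lam 1) ≤ 1) : HasDominantHead lam := by
  obtain ⟨hnonneg, hanti, hgap, hsum⟩ := hV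
  refine ⟨hnonneg, hsum, (hnonneg 1).trans_lt hgap, fun j hj => ?_⟩
  have hle : (1 : Fin d) ≤ j := by
    have hj0 : (j : ℕ) ≠ 0 := fun h => hj (Fin.ext (by simpa using h))
    rw [Fin.le_def, Fin.val_one', Nat.mod_eq_of_lt (by lia)]
    lia
  rw [div_le_one (sub_pos.2 hgap)] at hγ
  linarith [hanti 1 j hle]

namespace HasDominantHead

variable {d : ℕ} [NeZero d] {lam : Fin d → ℝ}

lemma map (h : HasDominantHead lam) : HasDominantHead (Fmap lam) := by
  obtain ⟨hnonneg, hsum, hpos, hhead⟩ := h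
  have hden : 0 < 1 + ∑ j, lam j ^ 2 := by positivity
  refine ⟨fun i => ?_, ?_, ?_, fun j hj => ?_⟩
  · have := hnonneg i
    unfold Fmap
    positivity
  · unfold Fmap
    rw [← Finset.sum_div, div_eq_one_iff_eq hden.ne']
    simp only [mul_add, mul_one, Finset.sum_add_distrib, hsum, pow_two]
    ring
  · unfold Fmap
    positivity
  · unfold Fmap
    rw [← mul_div_assoc]
    refine div_le_div_of_nonneg_right ?_ hden.le
    nlinarith [hnonneg j, hhead j hj]

lemma Evec_nonneg (h : HasDominantHead lam) : 0 ≤ Evec lam := by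
  obtain ⟨hnonneg, -, hpos, hhead⟩ := h
  refine Finset.sum_nonneg fun j hj => div_nonneg (hnonneg j) ?_
  linarith [hhead j (Finset.ne_of_mem_erase hj)]

lemma inv_head_le (h : HasDominantHead lam) : 1 / lam 0 ≤ 1 + Evec lam := by
  obtain ⟨hnonneg, hsum, hpos, hhead⟩ := h
  have htail : ∑ j ∈ Finset.univ.erase (0 : Fin d), lam j / lam 0 ≤ Evec lam := by
    refine Finset.sum_le_sum fun j hj => ?_
    have := hhead j (Finset.ne_of_mem_erase hj)
    have := hnonneg j
    exact div_le_div_of_nonneg_left (hnonneg j) (by linarith) (by linarith)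
  rw [← Finset.add_sum_erase _ _ (Finset.mem_univ (0 : Fin d))] at hsum
  rw [← Finset.sum_div, eq_sub_iff_add_eq'.2 hsum, sub_div, div_self hpos.ne'] at htail
  linarith

lemma Evec_map_le (h : HasDominantHead lam) :
    Evec (Fmap lam) ≤ (1 - 1 / (Evec lam + 5 / 2)) * Evec lam := by
  have hinv := h.inv_head_le
  have hE := h.Evec_nonneg
  obtain ⟨hnonneg, hsum, hpos, hhead⟩ := h
  have hden : 0 < 1 + ∑ j, lam j ^ 2 := by positivity
  conv_rhs => rw [Evec, Finset.mul_sum]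
  refine Finset.sum_le_sum fun j hj => ?_
  have hj2 := hhead j (Finset.ne_of_mem_erase hj)
  have hj0 := hnonneg j
  have hgap : 0 < lam 0 - lam j := by linarith
  have hfactor : Fmap lam j / (Fmap lam 0 - Fmap lam j) =
      (1 - lam 0 / (1 + lam 0 + lam j)) * (lam j / (lam 0 - lam j)) := by
    have hsub : Fmap lam 0 - Fmap lam j =
        (lam 0 - lam j) * (1 + lam 0 + lam j) / (1 + ∑ j, lam j ^ 2) := by
      unfold Fmap
      ring
    rw [hsub, Fmap, div_div_div_cancel_right₀ hden.ne']
    field_simp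
    ring
  rw [hfactor]
  refine mul_le_mul_of_nonneg_right (sub_le_sub_left ?_ _) (by positivity)
  rw [div_le_iff₀ hpos] at hinv
  change 1 / (Evec lam + 5 / 2) ≤ _
  rw [div_le_div_iff₀ (by positivity) (by positivity)]
  nlinarith

lemma iterate (h : HasDominantHead lam) (k : ℕ) : HasDominantHead (Fmap^[k] lam) := by
  induction k with
  | zero => exact h
  | succ k ih =>
    rw [Function.iterate_succ_apply']
    exact ih.map

lemma Evec_iterate_le (h : HasDominantHead lam) {A : ℝ} (hA : Evec lam ≤ A) (k : ℕ) :
    Evec (Fmap^[k] lam) ≤ (1 - 1 / (A + 5 / 2)) ^ k * A := by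
  have hA0 : 0 ≤ A := h.Evec_nonneg.trans hA
  have hrate : 0 ≤ 1 - 1 / (A + 5 / 2) := by
    rw [sub_nonneg, div_le_one (by positivity)]
    linarith
  have hrate' : 1 - 1 / (A + 5 / 2) ≤ 1 := sub_le_self _ (by positivity)
  induction k with
  | zero => simpa using hA
  | succ k ih =>
    have hk := h.iterate k
    have hEk := hk.Evec_nonneg
    have hle : Evec (Fmap^[k] lam) ≤ A :=
      ih.trans (mul_le_of_le_one_left hA0 (pow_le_one₀ hrate hrate'))
    rw [Function.iterate_succ_apply', pow_succ', mul_assoc]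
    refine hk.Evec_map_le.trans (mul_le_mul ?_ ih hEk hrate)
    gcongr

lemma exists_iterate_le_half (h : HasDominantHead lam) {A : ℝ} (hA : Evec lam ≤ A) :
    ∃ k : ℕ, (k : ℝ) ≤ 1 + (A + 5 / 2) * Real.log 2 ∧ Evec (Fmap^[k] lam) ≤ A / 2 := by
  have hA0 : 0 ≤ A := h.Evec_nonneg.trans hA
  have hlog : 0 < Real.log 2 := Real.log_pos one_lt_two
  have hrate : 0 ≤ 1 - 1 / (A + 5 / 2) := by
    rw [sub_nonneg, div_le_one (by positivity)]
    linarith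
  refine ⟨⌈(A + 5 / 2) * Real.log 2⌉₊, ?_, (h.Evec_iterate_le hA _).trans ?_⟩
  · linarith [Nat.ceil_lt_add_one (a := (A + 5 / 2) * Real.log 2) (by positivity)]
  · set k := ⌈(A + 5 / 2) * Real.log 2⌉₊ with hk
    have hceil : (A + 5 / 2) * Real.log 2 ≤ k := Nat.le_ceil _
    have hpow : (1 - 1 / (A + 5 / 2)) ^ k ≤ 1 / 2 := calc
      (1 - 1 / (A + 5 / 2)) ^ k ≤ Real.exp (-(1 / (A + 5 / 2))) ^ k :=
        pow_le_pow_left₀ hrate (Real.one_sub_le_exp_neg _) k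
      _ = Real.exp (-(k / (A + 5 / 2))) := by
        rw [← Real.exp_nat_mul]
        ring_nf
      _ ≤ Real.exp (-Real.log 2) := by
        gcongr
        rwa [le_div_iff₀' (by positivity)]
      _ = 1 / 2 := by
        rw [Real.exp_neg, Real.exp_log two_pos, one_div]
    calc _ ≤ 1 / 2 * A := by gcongr
      _ = A / 2 := by ring

lemma exists_iterate_le_div_two_pow (h : HasDominantHead lam) {A : ℝ} (hA : Evec lam ≤ A)
    (n : ℕ) :
    ∃ k : ℕ, (k : ℝ) ≤ 2 * A * Real.log 2 + (1 + 5 / 2 * Real.log 2) * n ∧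
      Evec (Fmap^[k] lam) ≤ A / 2 ^ n := by
  induction n generalizing lam A with
  | zero =>
    have hA0 : 0 ≤ A := h.Evec_nonneg.trans hA
    have hlog : 0 < Real.log 2 := Real.log_pos one_lt_two
    refine ⟨0, ?_, by simpa using hA⟩
    simp only [Nat.cast_zero, mul_zero, add_zero]
    positivity
  | succ n ih =>
    obtain ⟨k, hk, hkE⟩ := h.exists_iterate_le_half hA
    obtain ⟨m, hm, hmE⟩ := ih (h.iterate k) hkE
    refine ⟨m + k, ?_, ?_⟩
    · push_cast
      linarith
    · rw [Function.iterate_add_apply, pow_succ', ← div_div]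
      exact hmE

end HasDominantHead

/-- length of the second stage. -/
theorem stmt14 (d : ℕ) [NeZero d] (hd : 2 ≤ d) (lam : Fin d → ℝ) (hV : memV lam)
    (hγ : lam 1 / (lam 0 - lam 1) ≤ 1) (hE : 1/2 ≤ Evec lam) :
    ∃ l₂ : ℕ, (l₂ : ℝ) ≤ 2 * Evec lam * Real.log 2 +
        (1 + 5/2 * Real.log 2) * (⌈1 + Real.log (Evec lam) / Real.log 2⌉ : ℝ) ∧
      Evec (Fmap^[l₂] lam) ≤ 1/2 := by
  have hE0 : 0 < Evec lam := by linarith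
  have hlog : 0 < Real.log 2 := Real.log_pos one_lt_two
  have hceil_nonneg : 0 ≤ ⌈1 + Real.log (Evec lam) / Real.log 2⌉ := by
    refine Int.ceil_nonneg ?_
    have hle : Real.log (1 / 2) ≤ Real.log (Evec lam) := Real.log_le_log (by norm_num) hE
    rw [one_div, Real.log_inv] at hle
    have hdiv : -1 ≤ Real.log (Evec lam) / Real.log 2 := by
      rw [le_div_iff₀ hlog]
      linarith
    linarith
  obtain ⟨n, hn⟩ := Int.eq_ofNat_of_zero_le hceil_nonneg
  have hn_le : 1 + Real.log (Evec lam) / Real.log 2 ≤ n := by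
    have hle := Int.le_ceil (1 + Real.log (Evec lam) / Real.log 2)
    rwa [hn, Int.cast_natCast] at hle
  have hpow : 2 * Evec lam ≤ 2 ^ n := by
    rw [← Real.log_le_log_iff (by positivity) (by positivity),
      Real.log_mul two_ne_zero hE0.ne', Real.log_pow]
    have hmul := mul_le_mul_of_nonneg_right hn_le hlog.le
    rwa [add_mul, one_mul, div_mul_cancel₀ _ hlog.ne'] at hmul
  obtain ⟨k, hk, hkE⟩ :=
    (hV.hasDominantHead hd hγ).exists_iterate_le_div_two_pow le_rfl n
  refine ⟨k, ?_, hkE.trans ?_⟩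
  · rwa [hn, Int.cast_natCast]
  · rw [div_le_div_iff₀ (by positivity) two_pos]
    linarith
end
end

section
/- Let d ≥ 2 and λ ∈ V, and set λ' = F(λ). Then E(λ') ≤ ((1 + η(λ))/2)·E(λ), and moreover (1 + η(λ))/2 ≤ (1/2)·exp(η(λ)), so that E(λ') ≤ (1/2)·exp(η(λ))·E(λ). -/
open Finset

noncomputable section

theorem memV.add_le_one_s16 {d : ℕ} [NeZero d] {lam : Fin d → ℝ} (hV : memV lam)
    {j : Fin d} (hj : j ≠ 0) : lam 0 + lam j ≤ 1 := by
  rw [← hV.2.2.2, ← Finset.sum_pair hj.symm]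
  exact Finset.sum_le_sum_of_subset_of_nonneg (Finset.subset_univ _) fun i _ _ => hV.1 i

/-- The decay of a single term of `E` under the map `F`, before normalization. -/
theorem term_decay {a x c : ℝ} (hx : 0 ≤ x) (hxa : x < a) (hax : a + x ≤ 1) (hc : 0 < c) :
    x * (x + 1) / c / (a * (a + 1) / c - x * (x + 1) / c) ≤
      (1 + (1 - a)) / 2 * (x / (a - x)) := by
  have h : 0 < a - x := sub_pos.mpr hxa
  have hs : 0 < 1 + a + x := by linarith
  have hratio : (x + 1) / (1 + a + x) ≤ (1 + (1 - a)) / 2 := by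
    rw [div_le_div_iff₀ hs two_pos]
    nlinarith [mul_nonneg (hx.trans hxa.le) (sub_nonneg.mpr hax)]
  calc x * (x + 1) / c / (a * (a + 1) / c - x * (x + 1) / c)
      = (x + 1) / (1 + a + x) * (x / (a - x)) := by
        rw [← sub_div, div_div_div_cancel_right₀ hc.ne',
          show a * (a + 1) - x * (x + 1) = (1 + a + x) * (a - x) by ring, div_mul_div_comm,
          mul_comm x]
    _ ≤ _ := mul_le_mul_of_nonneg_right hratio (div_nonneg hx h.le)

/-- one-step decay of `E` in terms of `η`. -/
theorem stmt16 (d : ℕ) [NeZero d] (hd : 2 ≤ d) (lam : Fin d → ℝ) (hV : memV lam) :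
    Evec (Fmap lam) ≤ (1 + etaV lam) / 2 * Evec lam ∧
    (1 + etaV lam) / 2 ≤ 1/2 * Real.exp (etaV lam) ∧
    Evec (Fmap lam) ≤ 1/2 * Real.exp (etaV lam) * Evec lam := by
  have hE : 0 ≤ Evec lam := Finset.sum_nonneg fun j hj =>
    div_nonneg (hV.1 j) (sub_pos.mpr (hV.lt_zero hd (Finset.ne_of_mem_erase hj))).le
  have hF : Evec (Fmap lam) ≤ (1 + etaV lam) / 2 * Evec lam := by
    unfold Evec
    rw [Finset.mul_sum]
    refine Finset.sum_le_sum fun j hj => ?_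
    have hj0 := Finset.ne_of_mem_erase hj
    exact term_decay (hV.1 j) (hV.lt_zero hd hj0) (hV.add_le_one_s16 hj0)
      (add_pos_of_pos_of_nonneg one_pos (Finset.sum_nonneg fun i _ => sq_nonneg (lam i)))
  have hexp : (1 + etaV lam) / 2 ≤ 1/2 * Real.exp (etaV lam) := by
    linarith [Real.add_one_le_exp (etaV lam)]
  exact ⟨hF, hexp, hF.trans (mul_le_mul_of_nonneg_right hexp hE)⟩
end
end
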